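/- For a graph G = (V,E), the (r,q)-chromatic function M_{r,q}(G;k) = ∑_{s ∈ col(G;k)} r^{∑_{v} q^{s(v)}} satisfies M_{r,q}(G;k) = ∑_{A ⊆ E} (−1)^{|A|} ∏_{C ∈ com(A)} ∑_{i=0}^{k−1} r^{|C|·q^i}. -/

import Mathlib

open scoped Classical

/-- A (multi)graph with vertex set a finite set of naturals, edge labels a finite set of
naturals, each edge having an unordered pair of endpoints lying in the vertex set, and a
vertex-weight function. -/
structure WGraph where
  verts : Finset ℕ
  edges : Finset ℕ
  ends : ℕ → Sym2 ℕ
  ends_mem : ∀ e ∈ edges, ∀ v ∈ ends e, v ∈ verts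
  w : ℕ → ℕ

namespace WGraph

/-- Two vertices are joined in the spanning subgraph with edge set `A`. -/
def adj (G : WGraph) (A : Finset ℕ) (u v : ℕ) : Prop := ∃ i ∈ A, G.ends i = s(u, v)

/-- Reachability in the spanning subgraph with edge set `A`. -/
def reach (G : WGraph) (A : Finset ℕ) : ℕ → ℕ → Prop := Relation.ReflTransGen (G.adj A)

/-- The set of connected components of the spanning subgraph `(V, A)`. -/
noncomputable def components (G : WGraph) (A : Finset ℕ) : Finset (Finset ℕ) :=
  G.verts.image (fun v => G.verts.filter (G.reach A v))

/-- The total weight of a set of vertices. -/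
def wt (G : WGraph) (C : Finset ℕ) : ℕ := ∑ v ∈ C, G.w v

/-- All `k`-colourings: maps `V → {0, …, k-1}`, extended by `0` off the vertex set. -/
def allCol (G : WGraph) (k : ℕ) : Set (ℕ → ℕ) :=
  {s | (∀ v ∈ G.verts, s v < k) ∧ ∀ v ∉ G.verts, s v = 0}

/-- Proper `k`-colourings: no edge is monochromatic. -/
def properCol (G : WGraph) (k : ℕ) : Set (ℕ → ℕ) :=
  {s ∈ G.allCol k | ∀ e ∈ G.edges, ∀ a b : ℕ, G.ends e = s(a, b) → s a ≠ s b}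

/-- The weighted `(r,q)`-chromatic function
`M^ω_{r,q}(G;k) = ∑_{s ∈ col(G;k)} r^{∑_{v ∈ V} ω(v) q^{s(v)}}`. -/
noncomputable def Mw (G : WGraph) (r q : ℝ) (k : ℕ) : ℝ :=
  ∑ᶠ s ∈ G.properCol k, r ^ (∑ v ∈ G.verts, (G.w v : ℝ) * q ^ (s v))

/-- The unweighted `(r,q)`-chromatic function
`M_{r,q}(G;k) = ∑_{s ∈ col(G;k)} r^{∑_{v ∈ V} q^{s(v)}}`. -/
noncomputable def M (G : WGraph) (r q : ℝ) (k : ℕ) : ℝ :=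
  ∑ᶠ s ∈ G.properCol k, r ^ (∑ v ∈ G.verts, q ^ (s v))

/-- The weighted `(r,q)`-dichromatic function
`B^ω_{r,q}(G;x,k) = ∑_{A ⊆ E} x^{|A|} ∏_{C ∈ com(A)} ∑_{i=0}^{k-1} r^{ω(C) q^i}`. -/
noncomputable def Bw (G : WGraph) (r q x : ℝ) (k : ℕ) : ℝ :=
  ∑ A ∈ G.edges.powerset, x ^ A.card *
    ∏ C ∈ G.components A, ∑ i ∈ Finset.range k, r ^ ((G.wt C : ℝ) * q ^ i)

/-- The unweighted `(r,q)`-dichromatic function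
`B_{r,q}(G;x,k) = ∑_{A ⊆ E} x^{|A|} ∏_{C ∈ com(A)} ∑_{i=0}^{k-1} r^{|C| q^i}`. -/
noncomputable def B (G : WGraph) (r q x : ℝ) (k : ℕ) : ℝ :=
  ∑ A ∈ G.edges.powerset, x ^ A.card *
    ∏ C ∈ G.components A, ∑ i ∈ Finset.range k, r ^ ((C.card : ℝ) * q ^ i)

/-- Deletion of an edge. -/
def delete (G : WGraph) (e : ℕ) : WGraph where
  verts := G.verts
  edges := G.edges.erase e
  ends := G.ends
  ends_mem := fun i hi => G.ends_mem i (Finset.mem_of_mem_erase hi)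
  w := G.w

/-- Contraction of a non-loop edge `e` with ends `a`, `b`: the vertex `b` is merged into `a`,
whose new weight is `ω(a) + ω(b)`. -/
def contract (G : WGraph) (e a b : ℕ) : WGraph where
  verts := insert a (G.verts.erase b)
  edges := G.edges.erase e
  ends := fun i => (G.ends i).map (fun v => if v = b then a else v)
  ends_mem := by
    intro i hi v hv
    rcases Sym2.mem_map.1 hv with ⟨u, hu, rfl⟩
    by_cases h : u = b
    · simp [h]
    · simp only [if_neg h]
      exact Finset.mem_insert_of_mem
        (Finset.mem_erase.2 ⟨h, G.ends_mem i (Finset.mem_of_mem_erase hi) u hu⟩)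
  w := fun v => if v = a then G.w a + G.w b else G.w v

end WGraph

open WGraph

namespace WGraph

/-- The component of `v`. -/
noncomputable def cls (G : WGraph) (A : Finset ℕ) (v : ℕ) : Finset ℕ :=
  G.verts.filter (G.reach A v)

/-- The edge `e` is monochromatic under `s`. -/
def mono (G : WGraph) (s : ℕ → ℕ) (e : ℕ) : Prop :=
  ∀ a b : ℕ, G.ends e = s(a, b) → s a = s b

theorem not_mono_iff (G : WGraph) (s : ℕ → ℕ) (e : ℕ) :
    ¬ G.mono s e ↔ ∀ a b : ℕ, G.ends e = s(a, b) → s a ≠ s b := by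
  unfold mono
  induction h : G.ends e using Sym2.ind with
  | _ x y =>
    constructor
    · intro hn a b hab heq
      apply hn
      intro c d hcd
      rw [Sym2.eq_iff] at hab hcd
      rcases hab with ⟨rfl, rfl⟩ | ⟨rfl, rfl⟩ <;> rcases hcd with ⟨rfl, rfl⟩ | ⟨rfl, rfl⟩ <;>
        simp [heq]
    · intro hn hm
      exact hn x y rfl (hm x y rfl)

theorem adj_symm (G : WGraph) (A : Finset ℕ) {u v : ℕ} (h : G.adj A u v) : G.adj A v u := by
  obtain ⟨i, hi, h⟩ := h
  exact ⟨i, hi, h.trans Sym2.eq_swap⟩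

theorem reach_symm (G : WGraph) (A : Finset ℕ) {u v : ℕ} (h : G.reach A u v) :
    G.reach A v u := by
  unfold reach at *
  induction h with
  | refl => exact Relation.ReflTransGen.refl
  | tail _ h ih => exact Relation.ReflTransGen.head (G.adj_symm A h) ih

theorem cls_eq_of_reach (G : WGraph) (A : Finset ℕ) {u v : ℕ} (h : G.reach A u v) :
    G.cls A u = G.cls A v := by
  unfold cls
  apply Finset.filter_congr
  intro x _
  exact ⟨fun hx => Relation.ReflTransGen.trans (G.reach_symm A h) hx,
    fun hx => Relation.ReflTransGen.trans h hx⟩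

theorem mem_cls_self (G : WGraph) (A : Finset ℕ) {v : ℕ} (h : v ∈ G.verts) :
    v ∈ G.cls A v := Finset.mem_filter.2 ⟨h, Relation.ReflTransGen.refl⟩

theorem cls_mem (G : WGraph) (A : Finset ℕ) {v : ℕ} (h : v ∈ G.verts) :
    G.cls A v ∈ G.components A := Finset.mem_image_of_mem _ h

theorem color_eq_of_reach (G : WGraph) (A : Finset ℕ) (s : ℕ → ℕ)
    (hs : ∀ e ∈ A, G.mono s e) {u v : ℕ} (h : G.reach A u v) : s u = s v := by
  unfold reach at h
  induction h with
  | refl => rfl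
  | tail _ h ih =>
    obtain ⟨i, hi, h⟩ := h
    exact ih.trans (hs i hi _ _ h)

theorem fiber_eq (G : WGraph) (A : Finset ℕ) {C : Finset ℕ} (hC : C ∈ G.components A) :
    G.verts.filter (fun v => G.cls A v = C) = C := by
  obtain ⟨u, hu, rfl⟩ := Finset.mem_image.1 hC
  change _ = G.cls A u
  ext x
  simp only [Finset.mem_filter]
  constructor
  · rintro ⟨hx, h⟩
    change G.cls A x = G.cls A u at h
    rw [← h]
    exact G.mem_cls_self A hx
  · intro h
    have h' := Finset.mem_filter.1 h
    exact ⟨h'.1, (G.cls_eq_of_reach A h'.2).symm⟩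

theorem allCol_finite (G : WGraph) (k : ℕ) : (G.allCol k).Finite := by
  have h : G.allCol k ⊆ (fun p : (a : ℕ) → a ∈ G.verts → ℕ =>
      fun v => if h : v ∈ G.verts then p v h else 0) ''
      (↑(G.verts.pi (fun _ => Finset.range k)) : Set ((a : ℕ) → a ∈ G.verts → ℕ)) := by
    intro s hs
    refine ⟨fun v _ => s v, ?_, ?_⟩
    · simp only [Finset.mem_coe, Finset.mem_pi, Finset.mem_range]
      exact hs.1
    · funext v
      by_cases hv : v ∈ G.verts
      · simp [hv]
      · simp [hv, hs.2 v hv]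
  exact ((Finset.finite_toSet _).image _).subset h

theorem mono_sum (G : WGraph) (r q : ℝ) (hr : 0 < r) (k : ℕ) (A : Finset ℕ)
    (hA : A ⊆ G.edges) :
    ∑ s ∈ (G.allCol_finite k).toFinset with ∀ e ∈ A, G.mono s e,
      r ^ (∑ v ∈ G.verts, q ^ (s v)) =
    ∏ C ∈ G.components A, ∑ i ∈ Finset.range k, r ^ ((C.card : ℝ) * q ^ i) := by
  rw [Finset.prod_sum]
  symm
  refine Finset.sum_bij
    (fun p _ v => if h : v ∈ G.verts then p (G.cls A v) (G.cls_mem A h) else 0) ?_ ?_ ?_ ?_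
  · intro p hp
    simp only [Finset.mem_pi, Finset.mem_range] at hp
    simp only [Finset.mem_filter, Set.Finite.mem_toFinset]
    refine ⟨⟨?_, ?_⟩, ?_⟩
    · intro v hv
      simp only [hv, dif_pos]
      exact hp _ _
    · intro v hv
      simp [hv]
    · intro e he a b hab
      have ha : a ∈ G.verts := G.ends_mem e (hA he) a (by simp [hab])
      have hb : b ∈ G.verts := G.ends_mem e (hA he) b (by simp [hab])
      simp only [ha, hb, dif_pos]
      congr 1
      exact G.cls_eq_of_reach A (Relation.ReflTransGen.single ⟨e, he, hab⟩)
  · intro p _ p' _ h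
    funext C hC
    obtain ⟨u, hu, rfl⟩ := Finset.mem_image.1 hC
    have := congrFun h u
    simp only [hu, dif_pos] at this
    exact this
  · intro s hs
    simp only [Finset.mem_filter, Set.Finite.mem_toFinset] at hs
    obtain ⟨⟨h1, h2⟩, h3⟩ := hs
    have hex : ∀ C ∈ G.components A, ∃ u ∈ G.verts, G.cls A u = C := fun C hC =>
      Finset.mem_image.1 hC
    choose f hf hfc using hex
    refine ⟨fun C hC => s (f C hC), ?_, ?_⟩
    · simp only [Finset.mem_pi, Finset.mem_range]
      exact fun C hC => h1 _ (hf C hC)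
    · funext v
      by_cases hv : v ∈ G.verts
      · simp only [hv, dif_pos]
        apply G.color_eq_of_reach A s h3
        have := G.mem_cls_self A hv
        rw [← hfc _ (G.cls_mem A hv)] at this
        exact (Finset.mem_filter.1 this).2
      · simp [hv, h2 v hv]
  · intro p _
    rw [← Real.rpow_sum_of_pos hr]
    congr 1
    rw [← Finset.sum_fiberwise_of_maps_to (s := G.verts) (t := G.components A)
      (g := G.cls A) (fun v hv => G.cls_mem A hv)]
    rw [← Finset.sum_attach (G.components A)]
    refine Finset.sum_congr rfl ?_
    rintro ⟨C, hC⟩ _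
    dsimp only
    have : ∀ v ∈ G.verts.filter (fun v => G.cls A v = C),
        q ^ (if h : v ∈ G.verts then p (G.cls A v) (G.cls_mem A h) else 0) = q ^ (p C hC) := by
      intro v hv
      obtain ⟨hv1, rfl⟩ := Finset.mem_filter.1 hv
      simp [hv1]
    rw [Finset.sum_congr rfl this, G.fiber_eq A hC]
    simp

end WGraph

open WGraph

theorem M_subgraph_expansion (G : WGraph) (r q : ℝ) (hr : 0 < r) (k : ℕ) :
    G.M r q k =
      ∑ A ∈ G.edges.powerset, (-1 : ℝ) ^ A.card *
        ∏ C ∈ G.components A, ∑ i ∈ Finset.range k, r ^ ((C.card : ℝ) * q ^ i) := by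
  have h1 : G.M r q k = ∑ s ∈ (G.allCol_finite k).toFinset with
      ∀ e ∈ G.edges, ¬ G.mono s e, r ^ (∑ v ∈ G.verts, q ^ (s v)) := by
    unfold WGraph.M
    rw [← finsum_mem_coe_finset]
    apply finsum_mem_congr
    · ext s
      simp [properCol, not_mono_iff]
    · intro s _
      rfl
  have h2 : ∀ s : ℕ → ℕ, (if ∀ e ∈ G.edges, ¬ G.mono s e then (1 : ℝ) else 0) =
      ∑ A ∈ G.edges.powerset, (-1 : ℝ) ^ A.card * (if ∀ e ∈ A, G.mono s e then 1 else 0) := by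
    intro s
    have h3 : ∀ A : Finset ℕ, (-1 : ℝ) ^ A.card * (if ∀ e ∈ A, G.mono s e then 1 else 0) =
        ∏ e ∈ A, (-(if G.mono s e then (1 : ℝ) else 0)) := by
      intro A
      rw [Finset.prod_neg, Finset.prod_ite_zero]
      simp
    simp only [h3]
    rw [← Finset.prod_one_add]
    have h4 : ∀ e, (1 : ℝ) + -(if G.mono s e then (1 : ℝ) else 0) =
        if ¬ G.mono s e then 1 else 0 := by
      intro e
      by_cases h : G.mono s e <;> simp [h]
    simp only [h4]
    rw [Finset.prod_ite_zero]
    simp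
  rw [h1, Finset.sum_filter]
  have h5 : ∀ s : ℕ → ℕ, (if ∀ e ∈ G.edges, ¬ G.mono s e then
      r ^ (∑ v ∈ G.verts, q ^ (s v)) else 0) =
      ∑ A ∈ G.edges.powerset, (-1 : ℝ) ^ A.card *
        (if ∀ e ∈ A, G.mono s e then r ^ (∑ v ∈ G.verts, q ^ (s v)) else 0) := by
    intro s
    have := congrArg (· * r ^ (∑ v ∈ G.verts, q ^ (s v))) (h2 s)
    simpa only [Finset.sum_mul, mul_assoc, ite_mul, one_mul, zero_mul] using this
  simp only [h5]
  rw [Finset.sum_comm]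
  refine Finset.sum_congr rfl fun A hA => ?_
  rw [← Finset.mul_sum, ← Finset.sum_filter, G.mono_sum r q hr k A (Finset.mem_powerset.1 hA)]
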